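/- Let (Z_1,Z_2) be jointly Gaussian with Z_i ~ N(\mu_i,\sigma_i^2) (\sigma_i>0) and correlation \rho \in (-1,1), and set u_p = \Phi^{-1}(p). Then the marginal expected shortfall satisfies S(p) - \mu_1 - \sigma_1 \rho u_p \to 0 as p \uparrow 1. -/

import Mathlib

open MeasureTheory ProbabilityTheory Filter
open scoped Topology ENNReal

noncomputable section

/-- The standard normal distribution function `Φ`. -/
def stdNormalCDF (x : ℝ) : ℝ := (gaussianReal 0 1 (Set.Iic x)).toReal

/-- The standard normal quantile function `Φ⁻¹`. -/
def stdNormalQuantile (p : ℝ) : ℝ := sInf {x : ℝ | p ≤ stdNormalCDF x}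

/-- The standard normal density `φ = Φ'`. -/
def stdNormalPDF (x : ℝ) : ℝ := (Real.sqrt (2 * Real.pi))⁻¹ * Real.exp (-x ^ 2 / 2)

/-- The density `φ_ρ` of a centered bivariate Gaussian vector with unit variances and
correlation `ρ`. -/
def biStdGaussPDF (ρ : ℝ) (x y : ℝ) : ℝ :=
  (2 * Real.pi * Real.sqrt (1 - ρ ^ 2))⁻¹ *
    Real.exp (-(x ^ 2 - 2 * ρ * x * y + y ^ 2) / (2 * (1 - ρ ^ 2)))

/-- The density of a bivariate Gaussian vector with means `μ1, μ2`, standard deviations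
`σ1, σ2` and correlation `ρ`. -/
def biGaussPDF (μ1 μ2 σ1 σ2 ρ : ℝ) (z : ℝ × ℝ) : ℝ :=
  (σ1 * σ2)⁻¹ * biStdGaussPDF ρ ((z.1 - μ1) / σ1) ((z.2 - μ2) / σ2)

/-- The Value-at-Risk (quantile function) of `Z` at level `p`. -/
def VaR {Ω : Type*} [MeasurableSpace Ω] (P : Measure Ω) (Z : Ω → ℝ) (p : ℝ) : ℝ :=
  sInf {x : ℝ | p ≤ (P {ω | Z ω ≤ x}).toReal}

/-- The marginal mean excess `E(p) = E[(Z₁ - VaR_{Z₂}(p))₊ | Z₂ > VaR_{Z₂}(p)]`. -/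
def mme2 {Ω : Type*} [MeasurableSpace Ω] (P : Measure Ω) (Z1 Z2 : Ω → ℝ) (p : ℝ) : ℝ :=
  (∫ ω in {ω | VaR P Z2 p < Z2 ω}, max (Z1 ω - VaR P Z2 p) 0 ∂P) /
    (P {ω | VaR P Z2 p < Z2 ω}).toReal

/-- The marginal expected shortfall `S(p) = E[Z₁ | Z₂ > VaR_{Z₂}(p)]`. -/
def mes2 {Ω : Type*} [MeasurableSpace Ω] (P : Measure Ω) (Z1 Z2 : Ω → ℝ) (p : ℝ) : ℝ :=
  (∫ ω in {ω | VaR P Z2 p < Z2 ω}, Z1 ω ∂P) / (P {ω | VaR P Z2 p < Z2 ω}).toReal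

/-- `(Z₁,Z₂)` is, under `P`, bivariate Gaussian with marginals `N(μᵢ,σᵢ²)` and
correlation `ρ`. -/
def IsBiGaussian {Ω : Type*} [MeasurableSpace Ω] (P : Measure Ω) (Z1 Z2 : Ω → ℝ)
    (μ1 μ2 σ1 σ2 ρ : ℝ) : Prop :=
  Measure.map (fun ω => (Z1 ω, Z2 ω)) P =
    (volume : Measure (ℝ × ℝ)).withDensity fun z => ENNReal.ofReal (biGaussPDF μ1 μ2 σ1 σ2 ρ z)

local notation "γ" => gaussianReal 0 1

lemma aux_lint (m c : ℝ) (hc : 0 < c) (g : ℝ → ℝ≥0∞) (hg : Measurable g) :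
    ∫⁻ x, ENNReal.ofReal (c⁻¹ * stdNormalPDF ((x - m) / c)) * g x = ∫⁻ a, g (m + c * a) ∂γ := by
  have hmap : Measure.map (fun a => m + c * a) γ =
      gaussianReal m (NNReal.mk (c ^ 2) (sq_nonneg c)) := by
    have h := gaussianReal_map_const_add (μ := c * 0) (v := NNReal.mk (c ^ 2) (sq_nonneg c) * 1) m
    rw [← gaussianReal_map_const_mul, Measure.map_map (by fun_prop) (by fun_prop)] at h
    simp only [mul_zero, zero_add, mul_one] at h
    exact h
  have hv : NNReal.mk (c ^ 2) (sq_nonneg c) ≠ 0 := by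
    intro h
    have := congrArg NNReal.toReal h
    change c ^ 2 = 0 at this
    exact (pow_pos hc 2).ne' this
  rw [← lintegral_map (f := g) hg (by fun_prop), hmap, gaussianReal_of_var_ne_zero _ hv,
    lintegral_withDensity_eq_lintegral_mul _ (measurable_gaussianPDF _ _) hg]
  congr 1
  ext x
  simp only [Pi.mul_apply, gaussianPDF, gaussianPDFReal, stdNormalPDF]
  congr 2
  change _ = (√(2 * Real.pi * c ^ 2))⁻¹ * Real.exp (-(x - m) ^ 2 / (2 * c ^ 2))
  rw [Real.sqrt_mul (by positivity : (0 : ℝ) ≤ 2 * Real.pi) (c ^ 2), Real.sqrt_sq hc.le, mul_inv, ← mul_assoc, mul_comm c⁻¹]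
  congr 2
  field_simp

lemma pdf_factor (μ1 μ2 σ1 σ2 ρ : ℝ) (hσ1 : 0 < σ1) (hσ2 : 0 < σ2) (hρ : 0 < 1 - ρ ^ 2)
    (x y : ℝ) :
    biGaussPDF μ1 μ2 σ1 σ2 ρ (x, y) = (σ2⁻¹ * stdNormalPDF ((y - μ2) / σ2)) *
      ((σ1 * √(1 - ρ ^ 2))⁻¹ * stdNormalPDF ((x - (μ1 + σ1 * ρ * ((y - μ2) / σ2))) /
        (σ1 * √(1 - ρ ^ 2)))) := by
  have hs : 0 < √(1 - ρ ^ 2) := Real.sqrt_pos.2 hρ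
  have hs2 : √(1 - ρ ^ 2) ^ 2 = 1 - ρ ^ 2 := Real.sq_sqrt hρ.le
  have hp : √(2 * Real.pi) ^ 2 = 2 * Real.pi := Real.sq_sqrt (by positivity)
  have hp0 : 0 < √(2 * Real.pi) := Real.sqrt_pos.2 (by positivity)
  unfold biGaussPDF biStdGaussPDF stdNormalPDF
  simp only
  set s := √(1 - ρ ^ 2)
  set q := √(2 * Real.pi)
  obtain ⟨X, rfl⟩ : ∃ X, x = μ1 + σ1 * X := ⟨(x - μ1) / σ1, by field_simp; ring⟩
  obtain ⟨Y, rfl⟩ : ∃ Y, y = μ2 + σ2 * Y := ⟨(y - μ2) / σ2, by field_simp; ring⟩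
  have e1 : (μ1 + σ1 * X - μ1) / σ1 = X := by field_simp; ring
  have e2 : (μ2 + σ2 * Y - μ2) / σ2 = Y := by field_simp; ring
  have e3 : (μ1 + σ1 * X - (μ1 + σ1 * ρ * Y)) / (σ1 * s) = (X - ρ * Y) / s := by
    field_simp; ring
  rw [e1, e2, e3, ← hs2, ← hp]
  have e4 : -(X ^ 2 - 2 * ρ * X * Y + Y ^ 2) / (2 * s ^ 2) =
      -Y ^ 2 / 2 + -((X - ρ * Y) / s) ^ 2 / 2 := by
    field_simp
    rw [hs2]; ring
  rw [e4, Real.exp_add]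
  field_simp

lemma law_eq (μ1 μ2 σ1 σ2 ρ : ℝ) (hσ1 : 0 < σ1) (hσ2 : 0 < σ2) (hρ : 0 < 1 - ρ ^ 2) :
    ((volume : Measure (ℝ × ℝ)).withDensity fun z => ENNReal.ofReal (biGaussPDF μ1 μ2 σ1 σ2 ρ z))
      = Measure.map (fun z : ℝ × ℝ => (μ1 + σ1 * ρ * z.2 + σ1 * √(1 - ρ ^ 2) * z.1, μ2 + σ2 * z.2))
        ((γ).prod (γ)) := by
  have hs : 0 < √(1 - ρ ^ 2) := Real.sqrt_pos.2 hρ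
  have hm : Measurable fun z => ENNReal.ofReal (biGaussPDF μ1 μ2 σ1 σ2 ρ z) := by
    unfold biGaussPDF biStdGaussPDF
    fun_prop
  refine Measure.ext_of_lintegral _ fun f hf => ?_
  rw [lintegral_withDensity_eq_lintegral_mul _ hm hf, lintegral_map hf (by fun_prop),
    Measure.volume_eq_prod, lintegral_prod_symm _ (hm.mul hf).aemeasurable,
    lintegral_prod_symm _ (by fun_prop)]
  have key : ∀ y, ∫⁻ x, ((fun z => ENNReal.ofReal (biGaussPDF μ1 μ2 σ1 σ2 ρ z)) * f) (x, y) =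
      ENNReal.ofReal (σ2⁻¹ * stdNormalPDF ((y - μ2) / σ2)) *
       ∫⁻ a, f (μ1 + σ1 * ρ * ((y - μ2) / σ2) + σ1 * √(1 - ρ ^ 2) * a, y) ∂γ := by
    intro y
    rw [← aux_lint (μ1 + σ1 * ρ * ((y - μ2) / σ2)) (σ1 * √(1 - ρ ^ 2)) (by positivity)
      (fun x => f (x, y)) (by fun_prop), ← lintegral_const_mul]
    · congr 1
      ext x
      simp only [Pi.mul_apply]
      rw [pdf_factor _ _ _ _ _ hσ1 hσ2 hρ, ENNReal.ofReal_mul, mul_assoc]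
      unfold stdNormalPDF
      positivity
    · unfold stdNormalPDF
      fun_prop
  simp_rw [key]
  rw [aux_lint μ2 σ2 hσ2 (fun y => ∫⁻ a, f (μ1 + σ1 * ρ * ((y - μ2) / σ2) +
    σ1 * √(1 - ρ ^ 2) * a, y) ∂γ)]
  · have e2 : ∀ Y, (μ2 + σ2 * Y - μ2) / σ2 = Y := by intro Y; field_simp; ring
    simp_rw [e2]
  · apply Measurable.lintegral_prod_right'
      (f := fun z : ℝ × ℝ => f (μ1 + σ1 * ρ * ((z.1 - μ2) / σ2) + σ1 * √(1 - ρ ^ 2) * z.2, z.1))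
    fun_prop

lemma int_id : Integrable (fun x : ℝ => x) (γ) := by
  exact (memLp_id_gaussianReal (μ := 0) (v := 1) 1).integrable (by simp)

lemma int_sq : Integrable (fun x : ℝ => x ^ 2) (γ) := by
  simpa using (memLp_id_gaussianReal (μ := 0) (v := 1) 2).integrable_sq

lemma vol_int {g : ℝ → ℝ} (h : Integrable g (γ)) :
    Integrable (fun x => gaussianPDFReal 0 1 x * g x) := by
  rw [gaussianReal_of_var_ne_zero _ one_ne_zero,
    integrable_withDensity_iff_integrable_smul' (measurable_gaussianPDF _ _)
      (by simp [gaussianPDF])] at h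
  simpa using h

lemma vol_eq (g : ℝ → ℝ) (u : ℝ) : ∫ x in Set.Ioi u, g x ∂γ =
    ∫ x in Set.Ioi u, gaussianPDFReal 0 1 x * g x := by
  rw [gaussianReal_of_var_ne_zero _ one_ne_zero]
  rw [setIntegral_withDensity_eq_setIntegral_toReal_smul (measurable_gaussianPDF _ _)
      (by simp [gaussianPDF]) _ measurableSet_Ioi]
  simp

lemma stein (u : ℝ) : ∫ y in Set.Ioi u, y * (y - u) ∂γ = (γ).real (Set.Ioi u) := by
  have i1 : Integrable (fun y : ℝ => y * (y - u) - 1) (γ) := by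
    have := (int_sq.sub (int_id.const_mul u)).sub (integrable_const (1 : ℝ))
    refine this.congr (ae_of_all _ fun y => ?_)
    simp; ring
  have i0 : Integrable (fun y : ℝ => -(y - u)) (γ) :=
    (int_id.sub (integrable_const u)).neg
  have hd : ∀ x, HasDerivAt (fun y => gaussianPDFReal 0 1 y * (-(y - u)))
      (gaussianPDFReal 0 1 x * (x * (x - u) - 1)) x := by
    intro x
    have h1 : HasDerivAt (fun y : ℝ => -(y - 0) ^ 2 / (2 * ((1 : NNReal) : ℝ))) (-x) x := by
      have := (((hasDerivAt_id x).sub_const 0).pow 2).neg.div_const (2 * ((1 : NNReal) : ℝ))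
      refine HasDerivAt.congr_deriv this ?_
      simp
      ring
    have h2 := (h1.exp.const_mul (√(2 * Real.pi * ((1 : NNReal) : ℝ)))⁻¹).mul
      ((hasDerivAt_id x).sub_const u).neg
    refine HasDerivAt.congr_deriv h2 ?_
    simp only [gaussianPDFReal, Pi.neg_apply, id]
    ring
  have j1 := (vol_int i1).integrableOn (s := Set.Ioi u)
  have j0 := (vol_int i0).integrableOn (s := Set.Ioi u)
  have ht := tendsto_zero_of_hasDerivAt_of_integrableOn_Ioi (fun x _ => hd x) j1 j0
  have h := integral_Ioi_of_hasDerivAt_of_tendsto' (fun x _ => hd x) j1 ht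
  rw [← vol_eq] at h
  have i2 : Integrable (fun y : ℝ => y * (y - u)) (γ) := by
    refine (i1.add (integrable_const (1 : ℝ))).congr (ae_of_all _ fun y => ?_)
    simp
  rw [integral_sub i2.integrableOn (integrable_const _).integrableOn] at h
  simp at h
  linarith

lemma Q_pos (u : ℝ) : 0 < (γ).real (Set.Ioi u) := by
  refine ENNReal.toReal_pos ?_ (measure_ne_top _ _)
  intro h
  have := gaussianReal_absolutelyContinuous' 0 (one_ne_zero (α := NNReal)) h
  simp at this

lemma mills (u : ℝ) (hu : 0 < u) :
    0 ≤ (∫ y in Set.Ioi u, y ∂γ) / (γ).real (Set.Ioi u) - u ∧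
    (∫ y in Set.Ioi u, y ∂γ) / (γ).real (Set.Ioi u) - u ≤ u⁻¹ := by
  have hQ := Q_pos u
  have i0 : Integrable (fun y : ℝ => y - u) (γ) := int_id.sub (integrable_const u)
  have i2 : Integrable (fun y : ℝ => y * (y - u)) (γ) := by
    refine (int_sq.sub (int_id.const_mul u)).congr (ae_of_all _ fun y => ?_)
    simp; ring
  have hD : ∫ y in Set.Ioi u, (y - u) ∂γ = (∫ y in Set.Ioi u, y ∂γ) - (γ).real (Set.Ioi u) * u := by
    rw [integral_sub int_id.integrableOn (integrable_const _).integrableOn]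
    simp
  have h0 : 0 ≤ ∫ y in Set.Ioi u, (y - u) ∂γ :=
    setIntegral_nonneg measurableSet_Ioi fun y hy => by
      have : u < y := hy
      linarith
  have h1 : u * ∫ y in Set.Ioi u, (y - u) ∂γ ≤ (γ).real (Set.Ioi u) := by
    rw [← stein, ← integral_const_mul]
    refine setIntegral_mono_on (i0.const_mul u).integrableOn i2.integrableOn measurableSet_Ioi
      fun y hy => ?_
    have : u < y := hy
    nlinarith
  have e : (∫ y in Set.Ioi u, y ∂γ) / (γ).real (Set.Ioi u) - u =
      (∫ y in Set.Ioi u, (y - u) ∂γ) / (γ).real (Set.Ioi u) := by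
    rw [hD]; field_simp
  rw [e]
  refine ⟨by positivity, ?_⟩
  rw [div_le_iff₀ hQ, ← div_eq_inv_mul, le_div_iff₀ hu]
  linarith

lemma cdf_compl (x : ℝ) : stdNormalCDF x = 1 - (γ).real (Set.Ioi x) := by
  have := probReal_compl_eq_one_sub (μ := γ) (s := Set.Ioi x) measurableSet_Ioi
  rw [Set.compl_Ioi] at this
  exact this

lemma cdf_mono : Monotone stdNormalCDF := fun a b h =>
  ENNReal.toReal_mono (measure_ne_top _ _) (measure_mono (Set.Iic_subset_Iic.2 h))

lemma cdf_tendsto : Tendsto stdNormalCDF atTop (𝓝 1) := by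
  have := tendsto_measure_Iic_atTop (γ)
  rw [measure_univ] at this
  exact (ENNReal.tendsto_toReal ENNReal.one_ne_top).comp this

lemma cdf_tendsto_bot : Tendsto stdNormalCDF atBot (𝓝 0) := by
  have := tendsto_cdf_atBot (γ)
  refine this.congr fun x => ?_
  rw [cdf_eq_real]; rfl

lemma qset_ne {p : ℝ} (hp : p < 1) : {x : ℝ | p ≤ stdNormalCDF x}.Nonempty := by
  obtain ⟨x, hx⟩ := (cdf_tendsto.eventually (lt_mem_nhds hp)).exists
  exact ⟨x, hx.le⟩

lemma qset_bdd {p : ℝ} (hp : 0 < p) : BddBelow {x : ℝ | p ≤ stdNormalCDF x} := by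
  obtain ⟨x, hx⟩ := (cdf_tendsto_bot.eventually (gt_mem_nhds hp)).exists
  refine ⟨x, fun y hy => ?_⟩
  by_contra! h
  have := cdf_mono h.le
  have : p ≤ stdNormalCDF y := hy
  linarith

lemma quantile_tendsto : Tendsto stdNormalQuantile (𝓝[<] (1 : ℝ)) atTop := by
  rw [tendsto_atTop]
  intro M
  have hM : stdNormalCDF M < 1 := by
    rw [cdf_compl]; have := Q_pos M; linarith
  filter_upwards [self_mem_nhdsWithin, mem_nhdsWithin_of_mem_nhds (lt_mem_nhds hM)] with p hp1 hp2
  refine le_csInf (qset_ne hp1) fun y hy => ?_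
  by_contra! h
  have := cdf_mono h.le
  have : p ≤ stdNormalCDF y := hy
  linarith

/-- Theorem 1.1 v): the marginal expected shortfall satisfies
`S(p) - μ₁ - σ₁ρu_p → 0` as `p ↑ 1`. -/
theorem mes_bivariate_gaussian
    {Ω : Type*} [MeasurableSpace Ω] (P : Measure Ω) [IsProbabilityMeasure P]
    (Z1 Z2 : Ω → ℝ) (hZ1 : Measurable Z1) (hZ2 : Measurable Z2)
    (μ1 μ2 σ1 σ2 ρ : ℝ) (hσ1 : 0 < σ1) (hσ2 : 0 < σ2) (hρ1 : -1 < ρ) (hρ2 : ρ < 1)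
    (hjoint : IsBiGaussian P Z1 Z2 μ1 μ2 σ1 σ2 ρ) :
    Tendsto (fun p => mes2 P Z1 Z2 p - μ1 - σ1 * ρ * stdNormalQuantile p)
      (𝓝[<] (1 : ℝ)) (𝓝 0) := by
  have hρ : 0 < 1 - ρ ^ 2 := by nlinarith
  have hlaw : Measure.map (fun ω => (Z1 ω, Z2 ω)) P = _ :=
    Eq.trans hjoint (law_eq μ1 μ2 σ1 σ2 ρ hσ1 hσ2 hρ)
  set s := √(1 - ρ ^ 2)
  have hZ : Measurable fun ω => (Z1 ω, Z2 ω) := hZ1.prodMk hZ2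
  have hT : Measurable (fun z : ℝ × ℝ => (μ1 + σ1 * ρ * z.2 + σ1 * s * z.1, μ2 + σ2 * z.2)) := by
    fun_prop
  have hP : ∀ A : Set ℝ, MeasurableSet A →
      P {ω | Z2 ω ∈ A} = (γ) {b | μ2 + σ2 * b ∈ A} := by
    intro A hA
    have h1 : P {ω | Z2 ω ∈ A} = Measure.map (fun ω => (Z1 ω, Z2 ω)) P (Set.univ ×ˢ A) := by
      rw [Measure.map_apply hZ (MeasurableSet.univ.prod hA)]
      congr 1; ext ω; simp
    have h2 : (fun z : ℝ × ℝ => (μ1 + σ1 * ρ * z.2 + σ1 * s * z.1, μ2 + σ2 * z.2)) ⁻¹'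
        (Set.univ ×ˢ A) = Set.univ ×ˢ {b | μ2 + σ2 * b ∈ A} := by
      ext z; simp
    rw [h1, hlaw, Measure.map_apply hT (MeasurableSet.univ.prod hA), h2, Measure.prod_prod]
    simp
  have hset : ∀ u : ℝ, {b : ℝ | μ2 + σ2 * b ∈ Set.Ioi (μ2 + σ2 * u)} = Set.Ioi u := by
    intro u; ext b; simp [hσ2]
  have hmes : ∀ u : ℝ, (∫ ω in {ω | μ2 + σ2 * u < Z2 ω}, Z1 ω ∂P) /
      (P {ω | μ2 + σ2 * u < Z2 ω}).toReal =
      μ1 + σ1 * ρ * ((∫ y in Set.Ioi u, y ∂γ) / (γ).real (Set.Ioi u)) := by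
    intro u
    have hQ := Q_pos u
    have hden : (P {ω | μ2 + σ2 * u < Z2 ω}).toReal = (γ).real (Set.Ioi u) := by
      have := hP (Set.Ioi (μ2 + σ2 * u)) measurableSet_Ioi
      rw [hset] at this
      simp only [Set.mem_Ioi] at this
      rw [this]; rfl
    have hnum : (∫ ω in {ω | μ2 + σ2 * u < Z2 ω}, Z1 ω ∂P) =
        μ1 * (γ).real (Set.Ioi u) + σ1 * ρ * ∫ y in Set.Ioi u, y ∂γ := by
      have hA : MeasurableSet (Set.univ ×ˢ Set.Ioi (μ2 + σ2 * u) : Set (ℝ × ℝ)) :=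
        MeasurableSet.univ.prod measurableSet_Ioi
      have h1 := setIntegral_map (μ := P) (f := fun z : ℝ × ℝ => z.1) hA
        measurable_fst.aestronglyMeasurable hZ.aemeasurable
      have h2 := setIntegral_map (μ := (γ).prod (γ)) (f := fun z : ℝ × ℝ => z.1) hA
        measurable_fst.aestronglyMeasurable hT.aemeasurable
      rw [hlaw, h2] at h1
      have e1 : (fun ω => (Z1 ω, Z2 ω)) ⁻¹' (Set.univ ×ˢ Set.Ioi (μ2 + σ2 * u)) =
          {ω | μ2 + σ2 * u < Z2 ω} := by ext ω; simp
      have e2 : (fun z : ℝ × ℝ => (μ1 + σ1 * ρ * z.2 + σ1 * s * z.1, μ2 + σ2 * z.2)) ⁻¹'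
        (Set.univ ×ˢ Set.Ioi (μ2 + σ2 * u)) = Set.univ ×ˢ Set.Ioi u := by
        ext z; simp [hσ2]
      rw [e1, e2, ← Measure.prod_restrict, Measure.restrict_univ] at h1
      rw [← h1]
      have ia : Integrable (fun z : ℝ × ℝ => σ1 * s * z.1)
          ((γ).prod ((γ).restrict (Set.Ioi u))) := (int_id.const_mul (σ1 * s)).comp_fst _
      have ib : Integrable (fun z : ℝ × ℝ => μ1 + σ1 * ρ * z.2)
          ((γ).prod ((γ).restrict (Set.Ioi u))) :=
        Integrable.comp_snd (f := fun y : ℝ => μ1 + σ1 * ρ * y)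
          ((integrable_const μ1).add (int_id.const_mul (σ1 * ρ))).integrableOn _
      rw [integral_add ib ia, integral_fun_fst (fun x : ℝ => σ1 * s * x),
        integral_fun_snd (fun y : ℝ => μ1 + σ1 * ρ * y), integral_const_mul,
        integral_id_gaussianReal, integral_add (integrable_const _)
          (int_id.const_mul (σ1 * ρ)).integrableOn, integral_const_mul]
      simp
      ring
    rw [hden, hnum]
    field_simp
  have hVaR : ∀ p : ℝ, 0 < p → p < 1 → VaR P Z2 p = μ2 + σ2 * stdNormalQuantile p := by
    intro p h0 h1
    have hmono : Monotone fun x : ℝ => μ2 + σ2 * x := fun a b h => by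
      simp only; gcongr
    have := hmono.map_csInf_of_continuousAt (A := {x : ℝ | p ≤ stdNormalCDF x})
      (by fun_prop) (qset_ne h1) (qset_bdd h0)
    unfold VaR stdNormalQuantile
    rw [this]
    congr 1
    have hc : ∀ u, (P {ω | Z2 ω ≤ μ2 + σ2 * u}).toReal = stdNormalCDF u := by
      intro u
      have h := hP (Set.Iic (μ2 + σ2 * u)) measurableSet_Iic
      have e : {b : ℝ | μ2 + σ2 * b ∈ Set.Iic (μ2 + σ2 * u)} = Set.Iic u := by
        ext b; simp [hσ2]
      rw [e] at h
      simp only [Set.mem_Iic] at h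
      rw [h]; rfl
    ext x
    simp only [Set.mem_setOf_eq, Set.mem_image]
    constructor
    · intro hx
      have e : μ2 + σ2 * ((x - μ2) / σ2) = x := by field_simp; ring
      refine ⟨(x - μ2) / σ2, ?_, e⟩
      rw [← hc, e]; exact hx
    · rintro ⟨u, hu, rfl⟩
      rw [hc]; exact hu
  have hq := quantile_tendsto
  have hlim : Tendsto (fun u : ℝ => (∫ y in Set.Ioi u, y ∂γ) / (γ).real (Set.Ioi u) - u)
      atTop (𝓝 0) := by
    refine tendsto_of_tendsto_of_tendsto_of_le_of_le' tendsto_const_nhds tendsto_inv_atTop_zero ?_ ?_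
    · filter_upwards [eventually_gt_atTop 0] with u hu using (mills u hu).1
    · filter_upwards [eventually_gt_atTop 0] with u hu using (mills u hu).2
  have hfin := (hlim.comp hq).const_mul (σ1 * ρ)
  rw [mul_zero] at hfin
  refine hfin.congr' ?_
  filter_upwards [self_mem_nhdsWithin,
    mem_nhdsWithin_of_mem_nhds (lt_mem_nhds (zero_lt_one (α := ℝ)))] with p hp1 hp2
  unfold mes2
  rw [hVaR p hp2 hp1, hmes]
  simp only [Function.comp]
  ring
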